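/- arXiv:2101.12459 — 3 statements merged into one kernel-verified Lean document; each statement's English description precedes it below -/
import Mathlib

section
/- For all location parameters l1, l2 ∈ ℝ and scale parameters s1, s2 > 0, the Kullback-Leibler divergence between Cauchy densities, ∫_ℝ p_{l1,s1}(x) * log(p_{l1,s1}(x)/p_{l2,s2}(x)) dx, equals log(((s1+s2)^2 + (l1-l2)^2)/(4*s1*s2)). -/
open MeasureTheory Real

noncomputable def cauchyPdf (l s x : ℝ) : ℝ := s / (Real.pi * (s ^ 2 + (x - l) ^ 2))

/-- Mean value property for the logarithm of an affine function without zeros in the disc. -/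
theorem kl_cauchy_aux_mean (A B : ℂ) (hAB : ‖A‖ < ‖B‖) :
    ∫ t in (-(π / 2))..(π / 2), Real.log ‖A * circleMap 0 1 (2 * t) + B‖
      = π * Real.log ‖B‖ := by
  have hmean : circleAverage (fun z : ℂ => Real.log ‖A * z + B‖) 0 1 = Real.log ‖B‖ := by
    have h := AnalyticOnNhd.circleAverage_log_norm_of_ne_zero (R := 1) (c := 0)
      (g := fun z : ℂ => A * z + B) (fun z _ => by fun_prop) (by
        intro u hu h0
        have hu' : ‖u‖ ≤ 1 := by simpa using hu
        have h1 : B = -(A * u) := by linear_combination h0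
        have h2 : ‖B‖ = ‖A‖ * ‖u‖ := by rw [h1, norm_neg, norm_mul]
        nlinarith [norm_nonneg A, norm_nonneg u])
    simpa using h
  rw [circleAverage_def] at hmean
  have hper : (fun θ : ℝ => Real.log ‖A * circleMap 0 1 θ + B‖).Periodic (2 * π) :=
    fun x => by simp [periodic_circleMap 0 1 x]
  have hshift := hper.intervalIntegral_add_eq (-π) 0
  have e1 : -π + 2 * π = π := by ring
  rw [e1, zero_add] at hshift
  have hsub := intervalIntegral.integral_comp_mul_left (a := -(π / 2)) (b := π / 2)
    (fun θ : ℝ => Real.log ‖A * circleMap 0 1 θ + B‖) (c := 2) two_ne_zero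
  have e2 : 2 * (-(π / 2)) = -π := by ring
  have e3 : 2 * (π / 2) = π := by ring
  rw [e2, e3, hshift] at hsub
  rw [hsub, ← hmean]
  simp only [smul_eq_mul]
  have := pi_ne_zero
  field_simp

theorem kl_cauchy_aux_norm (d s₁ s₂ t : ℝ) :
    ‖(⟨d, s₂ - s₁⟩ : ℂ) * circleMap 0 1 (2 * t) + ⟨d, s₁ + s₂⟩‖ ^ 2
      = 4 * ((s₂ * cos t) ^ 2 + (d * cos t + s₁ * sin t) ^ 2) := by
  have hc : circleMap 0 1 (2 * t) = ⟨cos (2 * t), sin (2 * t)⟩ := by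
    apply Complex.ext
    · simp [circleMap, Complex.exp_re]
    · simp [circleMap, Complex.exp_im]
  rw [hc, Complex.sq_norm, Complex.normSq_apply]
  simp only [Complex.add_re, Complex.mul_re, Complex.add_im, Complex.mul_im]
  rw [cos_two_mul, sin_two_mul]
  have h : sin t ^ 2 = 1 - cos t ^ 2 := by rw [sin_sq]
  ring_nf
  have h4 : sin t ^ 2 * cos t ^ 2 = (1 - cos t ^ 2) * cos t ^ 2 := by rw [h]
  have h3 : sin t ^ 2 = 1 - cos t ^ 2 := h
  simp only [h3]
  ring

theorem kl_cauchy (l₁ l₂ s₁ s₂ : ℝ) (hs₁ : 0 < s₁) (hs₂ : 0 < s₂) :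
    ∫ x : ℝ, cauchyPdf l₁ s₁ x * Real.log (cauchyPdf l₁ s₁ x / cauchyPdf l₂ s₂ x)
      = Real.log (((s₁ + s₂) ^ 2 + (l₁ - l₂) ^ 2) / (4 * s₁ * s₂)) := by
  have hpi := pi_pos
  set c : ℝ := (2 * √(s₁ * s₂))⁻¹ with hc
  have hss : 0 < s₁ * s₂ := mul_pos hs₁ hs₂
  have hcpos : 0 < c := by positivity
  have hc2 : c ^ 2 = (4 * s₁ * s₂)⁻¹ := by
    rw [hc, inv_pow, mul_pow, sq_sqrt hss.le]; ring
  set A : ℂ := ⟨l₁ - l₂, s₂ - s₁⟩ with hA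
  set B : ℂ := ⟨l₁ - l₂, s₁ + s₂⟩ with hB
  have hB2 : ‖B‖ ^ 2 = (s₁ + s₂) ^ 2 + (l₁ - l₂) ^ 2 := by
    rw [Complex.sq_norm, Complex.normSq_apply]; simp only [hB]; ring
  have hA2 : ‖A‖ ^ 2 = (s₂ - s₁) ^ 2 + (l₁ - l₂) ^ 2 := by
    rw [Complex.sq_norm, Complex.normSq_apply]; simp only [hA]; ring
  have hAB : ‖A‖ < ‖B‖ := by
    apply lt_of_pow_lt_pow_left₀ 2 (norm_nonneg _)
    rw [hA2, hB2]; nlinarith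
  have hcn : ‖(c : ℂ)‖ = c := by simp [abs_of_pos hcpos]
  have hAB' : ‖(c : ℂ) * A‖ < ‖(c : ℂ) * B‖ := by
    rw [norm_mul, norm_mul, hcn]; exact mul_lt_mul_of_pos_left hAB hcpos
  have key := kl_cauchy_aux_mean _ _ hAB'
  have himg : (fun t => l₁ + s₁ * tan t) '' Set.Ioo (-(π / 2)) (π / 2) = Set.univ := by
    rw [Set.eq_univ_iff_forall]
    intro x
    refine ⟨arctan ((x - l₁) / s₁), arctan_mem_Ioo _, ?_⟩
    simp only [tan_arctan]
    field_simp
    ring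
  have hcv := integral_image_eq_integral_abs_deriv_smul (s := Set.Ioo (-(π / 2)) (π / 2))
    (f := fun t => l₁ + s₁ * tan t) (f' := fun t => s₁ * (1 / cos t ^ 2)) measurableSet_Ioo
    (fun t ht => (((hasDerivAt_tan_of_mem_Ioo ht).const_mul s₁).const_add l₁).hasDerivWithinAt)
    (by
      intro x hx y hy h
      apply injOn_tan hx hy
      have h' : l₁ + s₁ * tan x = l₁ + s₁ * tan y := h
      exact mul_left_cancel₀ hs₁.ne' (add_left_cancel h'))
    (fun x => cauchyPdf l₁ s₁ x * Real.log (cauchyPdf l₁ s₁ x / cauchyPdf l₂ s₂ x))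
  rw [himg, Measure.restrict_univ] at hcv
  rw [hcv]
  have hcongr : ∀ t ∈ Set.Ioo (-(π / 2)) (π / 2),
      |s₁ * (1 / cos t ^ 2)| • (cauchyPdf l₁ s₁ (l₁ + s₁ * tan t) *
        Real.log (cauchyPdf l₁ s₁ (l₁ + s₁ * tan t) / cauchyPdf l₂ s₂ (l₁ + s₁ * tan t)))
      = (2 / π) * Real.log ‖(c : ℂ) * A * circleMap 0 1 (2 * t) + (c : ℂ) * B‖ := by
    intro t ht
    have hcos : 0 < cos t := cos_pos_of_mem_Ioo ht
    have hn : ‖(c : ℂ) * A * circleMap 0 1 (2 * t) + (c : ℂ) * B‖ ^ 2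
        = ((s₂ * cos t) ^ 2 + ((l₁ - l₂) * cos t + s₁ * sin t) ^ 2) / (s₁ * s₂) := by
      have e : (c : ℂ) * A * circleMap 0 1 (2 * t) + (c : ℂ) * B
          = c * (A * circleMap 0 1 (2 * t) + B) := by ring
      rw [e, norm_mul, mul_pow, hcn, hc2, kl_cauchy_aux_norm]
      field_simp
    have hp : cauchyPdf l₁ s₁ (l₁ + s₁ * tan t) = cos t ^ 2 / (π * s₁) := by
      have e : s₁ ^ 2 + (l₁ + s₁ * tan t - l₁) ^ 2 = s₁ ^ 2 / cos t ^ 2 := by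
        rw [tan_eq_sin_div_cos]
        field_simp
        linear_combination s₁ ^ 2 * sin_sq_add_cos_sq t
      rw [cauchyPdf, e]
      field_simp
    have hr : cauchyPdf l₁ s₁ (l₁ + s₁ * tan t) / cauchyPdf l₂ s₂ (l₁ + s₁ * tan t)
        = ‖(c : ℂ) * A * circleMap 0 1 (2 * t) + (c : ℂ) * B‖ ^ 2 := by
      have e : s₂ ^ 2 + (l₁ + s₁ * tan t - l₂) ^ 2
          = ((s₂ * cos t) ^ 2 + ((l₁ - l₂) * cos t + s₁ * sin t) ^ 2) / cos t ^ 2 := by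
        rw [tan_eq_sin_div_cos]
        field_simp
        ring
      have hpos : 0 < (s₂ * cos t) ^ 2 + ((l₁ - l₂) * cos t + s₁ * sin t) ^ 2 := by positivity
      rw [hn, hp, cauchyPdf, e]
      generalize (s₂ * cos t) ^ 2 + ((l₁ - l₂) * cos t + s₁ * sin t) ^ 2 = q at hpos
      field_simp
    rw [hr, hp, Real.log_pow, abs_of_pos (by positivity), smul_eq_mul]
    push_cast
    field_simp
  rw [setIntegral_congr_fun measurableSet_Ioo hcongr, ← integral_Ioc_eq_integral_Ioo,
    ← intervalIntegral.integral_of_le (by linarith), intervalIntegral.integral_const_mul, key,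
    norm_mul, hcn, div_eq_mul_inv ((s₁ + s₂) ^ 2 + (l₁ - l₂) ^ 2), ← hB2, ← hc2, ← mul_pow,
    Real.log_pow, mul_comm c]
  push_cast
  field_simp
end

section
/- For all l1, l2 ∈ ℝ and s1, s2 > 0, the Jensen-Shannon divergence between Cauchy densities p_{l1,s1} and p_{l2,s2} equals log( 2*sqrt((l1-l2)^2 + (s1+s2)^2) / ( sqrt((l1-l2)^2 + (s1+s2)^2) + 2*sqrt(s1*s2) ) ). -/
open MeasureTheory Real

lemma norm_aux (d s σ θ : ℝ) (hs : 0 < s) (hσ : 0 < σ) (hc : cos ((θ - π)/2) ≠ 0) :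
    log (σ^2 + (d + s * tan ((θ - π)/2))^2) =
      log (d^2 + (s+σ)^2) + (2 * log ‖circleMap 0 1 θ - (⟨d, -(σ - s)⟩ / ⟨d, -(σ + s)⟩ : ℂ)‖
        - 2 * log ‖circleMap 0 1 θ - 1‖) := by
  set u := (θ - π)/2 with hu
  have hθ : θ = 2 * u + π := by rw [hu]; ring
  have hA : (⟨d, -(σ + s)⟩ : ℂ) ≠ 0 := by
    intro h
    have := congrArg Complex.im h
    simp at this
    linarith
  have hw : circleMap 0 1 θ = ⟨-(2 * cos u ^ 2 - 1), -(2 * sin u * cos u)⟩ := by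
    apply Complex.ext
    · simp [circleMap, Complex.exp_ofReal_mul_I_re]; rw [hθ, cos_add_pi, cos_two_mul]; ring
    · simp [circleMap, Complex.exp_ofReal_mul_I_im]; rw [hθ, sin_add_pi, sin_two_mul]
  have hAn : 0 < d^2 + (s+σ)^2 := by positivity
  have hcs : sin u ^ 2 = 1 - cos u ^ 2 := by rw [sin_sq]
  have hn1 : ‖circleMap 0 1 θ - 1‖^2 = 4 * cos u ^ 2 := by
    rw [Complex.sq_norm, hw, Complex.normSq_apply]
    simp
    ring_nf
    rw [hcs]; ring
  have hX : 0 < σ^2 + (d + s * tan u)^2 := by positivity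
  have hn2 : ‖circleMap 0 1 θ - (⟨d, -(σ - s)⟩ / ⟨d, -(σ + s)⟩ : ℂ)‖^2
      = 4 * cos u ^ 2 * (σ^2 + (d + s * tan u)^2) / (d^2 + (s+σ)^2) := by
    have : circleMap 0 1 θ - (⟨d, -(σ - s)⟩ / ⟨d, -(σ + s)⟩ : ℂ) =
      (circleMap 0 1 θ * ⟨d, -(σ + s)⟩ - ⟨d, -(σ - s)⟩) / ⟨d, -(σ + s)⟩ := by
      field_simp
    rw [this, norm_div, div_pow, Complex.sq_norm, Complex.sq_norm, hw]
    have e2 : Complex.normSq ⟨d, -(σ + s)⟩ = d^2 + (s+σ)^2 := by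
      rw [Complex.normSq_apply]; ring
    rw [e2]
    congr 1
    have ht : tan u = sin u / cos u := tan_eq_sin_div_cos u
    have e3 : 4 * cos u ^ 2 * (σ^2 + (d + s * tan u)^2) =
      4 * (cos u ^ 2 * σ^2 + (d * cos u + s * sin u)^2) := by
      rw [ht]; field_simp
    rw [e3, Complex.normSq_apply]
    simp
    linear_combination (4*cos u^2*(d^2+(σ+s)^2) - 4*s^2) * hcs
  have h1 : 2 * log ‖circleMap 0 1 θ - 1‖ = log (4 * cos u ^ 2) := by
    rw [← hn1, log_pow]; norm_num
  have h2 : 2 * log ‖circleMap 0 1 θ - (⟨d, -(σ - s)⟩ / ⟨d, -(σ + s)⟩ : ℂ)‖ =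
     log (4 * cos u ^ 2 * (σ^2 + (d + s * tan u)^2) / (d^2 + (s+σ)^2)) := by
    rw [← hn2, log_pow]; norm_num
  have hc2 : 4 * cos u ^ 2 ≠ 0 := by positivity
  rw [h1, h2, log_div (by positivity) hAn.ne', log_mul hc2 hX.ne']
  ring

lemma key_sub (l s : ℝ) (hs : 0 < s) (g : ℝ → ℝ) (h : ℝ → ℝ)
    (hgh : ∀ θ ∈ Set.Ioo 0 (2*π), g (l + s * tan ((θ - π)/2)) = h θ)
    (hi : IntervalIntegrable h volume 0 (2*π)) :
    Integrable (fun x => cauchyPdf l s x * g x) ∧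
    ∫ x, cauchyPdf l s x * g x = (2*π)⁻¹ * ∫ θ in (0)..(2*π), h θ := by
  set f : ℝ → ℝ := fun θ => l + s * tan ((θ - π)/2) with hf
  set f' : ℝ → ℝ := fun θ => s * ((1 / cos ((θ - π)/2)^2) * (1/2)) with hf'
  have hmem : ∀ θ ∈ Set.Ioo 0 (2*π), (θ - π)/2 ∈ Set.Ioo (-(π/2)) (π/2) := by
    intro θ h; constructor <;> linarith [h.1, h.2]
  have hcos : ∀ θ ∈ Set.Ioo 0 (2*π), 0 < cos ((θ - π)/2) := fun θ h => cos_pos_of_mem_Ioo (hmem θ h)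
  have hder : ∀ θ ∈ Set.Ioo 0 (2*π), HasDerivWithinAt f (f' θ) (Set.Ioo 0 (2*π)) θ := by
    intro θ h
    have h1 := hasDerivAt_tan (hcos θ h).ne'
    have h2 : HasDerivAt (fun θ : ℝ => (θ - π)/2) (1/2) θ :=
      ((hasDerivAt_id θ).sub_const π).div_const 2
    exact (((h1.comp θ h2).const_mul s).const_add l).hasDerivWithinAt
  have hinj : Set.InjOn f (Set.Ioo 0 (2*π)) := by
    intro a ha b hb hab
    have h1 : tan ((a - π)/2) = tan ((b - π)/2) := by
      have : s * tan ((a - π)/2) = s * tan ((b - π)/2) := by simpa [hf] using hab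
      exact mul_left_cancel₀ hs.ne' this
    have := injOn_tan (hmem a ha) (hmem b hb) h1
    linarith
  have himg : f '' (Set.Ioo 0 (2*π)) = Set.univ := by
    rw [Set.eq_univ_iff_forall]
    intro x
    refine ⟨π + 2 * arctan ((x - l)/s), ?_, ?_⟩
    · constructor <;> linarith [neg_pi_div_two_lt_arctan ((x-l)/s), arctan_lt_pi_div_two ((x-l)/s)]
    · have : (π + 2 * arctan ((x - l)/s) - π)/2 = arctan ((x - l)/s) := by ring
      simp only [hf, this, tan_arctan]
      field_simp; ring
  have heq : ∀ θ ∈ Set.Ioo 0 (2*π), |f' θ| • (cauchyPdf l s (f θ) * g (f θ)) = (2*π)⁻¹ * h θ := by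
    intro θ hθ
    have hc := hcos θ hθ
    have hp : 0 ≤ f' θ := by simp only [hf']; positivity
    rw [abs_of_nonneg hp, hgh θ hθ, smul_eq_mul, ← mul_assoc]
    congr 1
    simp only [hf', hf, cauchyPdf, tan_eq_sin_div_cos]
    have : s^2 + (l + s * (sin ((θ - π)/2) / cos ((θ - π)/2)) - l)^2 = s^2 / cos ((θ - π)/2)^2 := by
      field_simp
      linear_combination s^2 * sin_sq_add_cos_sq ((θ - π)/2)
    rw [this]
    field_simp
  have hpi : (0:ℝ) ≤ 2 * π := by positivity
  have hi2 : IntegrableOn h (Set.Ioo 0 (2*π)) :=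
    (intervalIntegrable_iff_integrableOn_Ioo_of_le hpi).1 hi
  constructor
  · rw [← integrableOn_univ, ← himg,
      integrableOn_image_iff_integrableOn_abs_deriv_smul measurableSet_Ioo hder hinj]
    exact (integrableOn_congr_fun heq measurableSet_Ioo).2 (hi2.const_mul _)
  · rw [← setIntegral_univ, ← himg,
      integral_image_eq_integral_abs_deriv_smul measurableSet_Ioo hder hinj,
      setIntegral_congr_fun measurableSet_Ioo heq, integral_const_mul,
      intervalIntegral.integral_of_le hpi, integral_Ioc_eq_integral_Ioo]

lemma cint (a : ℂ) : IntervalIntegrable (fun θ => log ‖circleMap 0 1 θ - a‖) volume 0 (2*π) := by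
  have : CircleIntegrable (fun z : ℂ => log ‖z - a‖) 0 1 := 
    circleIntegrable_log_norm_sub_const 1
  exact this

lemma key (l s m σ : ℝ) (hs : 0 < s) (hσ : 0 < σ) :
    Integrable (fun x => cauchyPdf l s x * log (σ^2 + (x - m)^2)) ∧
    ∫ x, cauchyPdf l s x * log (σ^2 + (x - m)^2) = log ((l - m)^2 + (s+σ)^2) := by
  set a : ℂ := (⟨l - m, -(σ - s)⟩ / ⟨l - m, -(σ + s)⟩ : ℂ) with ha
  have han : ‖a‖ < 1 := by
    rw [ha, norm_div]
    have hn : ∀ x y : ℝ, ‖(⟨x, y⟩:ℂ)‖ = √(x*x + y*y) := fun x y => by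
      rw [Complex.norm_def, Complex.normSq_apply]
    rw [hn, hn, div_lt_one (Real.sqrt_pos.2 (by nlinarith [mul_self_nonneg (l - m), mul_pos hs hσ, mul_pos hs hs, mul_pos hσ hσ]))]
    apply Real.sqrt_lt_sqrt (add_nonneg (mul_self_nonneg _) (mul_self_nonneg _))
    nlinarith [mul_pos hs hσ]
  have h0 : ∫ θ in (0)..(2*π), log ‖circleMap 0 1 θ - a‖ = 0 := by
    have := circleAverage_log_norm_sub_const₀ han
    rw [circleAverage_def, smul_eq_mul] at this
    exact (mul_eq_zero.1 this).resolve_left (by positivity)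
  have h1 : ∫ θ in (0)..(2*π), log ‖circleMap 0 1 θ - 1‖ = 0 := by
    have := circleAverage_log_norm_sub_const₁ (a := 1) (by simp)
    rw [circleAverage_def, smul_eq_mul] at this
    exact (mul_eq_zero.1 this).resolve_left (by positivity)
  have i1 := (cint a).const_mul 2
  have i2 := (cint 1).const_mul 2
  have ic : IntervalIntegrable (fun _ : ℝ => log ((l - m)^2 + (s+σ)^2)) volume 0 (2*π) :=
    intervalIntegrable_const
  have := key_sub l s hs (fun x => log (σ^2 + (x - m)^2)) _ (fun θ hθ => by
    have hc : cos ((θ - π)/2) ≠ 0 := (cos_pos_of_mem_Ioo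
      ⟨by linarith [hθ.1], by linarith [hθ.2]⟩).ne'
    have := norm_aux (l - m) s σ θ hs hσ hc
    rw [← this]
    congr 3; ring) (ic.add (i1.sub i2))
  refine ⟨this.1, this.2.trans ?_⟩
  rw [intervalIntegral.integral_add ic (i1.sub i2), intervalIntegral.integral_sub i1 i2,
    intervalIntegral.integral_const_mul, intervalIntegral.integral_const_mul, h0, h1]
  simp
  field_simp

lemma key_one (l s : ℝ) (hs : 0 < s) (c : ℝ) :
    Integrable (fun x => cauchyPdf l s x * c) ∧ ∫ x, cauchyPdf l s x * c = c := by
  have := key_sub l s hs (fun _ => c) (fun _ => c) (fun _ _ => rfl) intervalIntegrable_const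
  refine ⟨this.1, this.2.trans ?_⟩
  simp
  field_simp

lemma half (l₁ l₂ s₁ s₂ : ℝ) (hs₁ : 0 < s₁) (hs₂ : 0 < s₂) :
    (∫ x : ℝ, cauchyPdf l₁ s₁ x *
        Real.log (cauchyPdf l₁ s₁ x / ((cauchyPdf l₁ s₁ x + cauchyPdf l₂ s₂ x) / 2)))
      = Real.log (2 * Real.sqrt ((l₁ - l₂) ^ 2 + (s₁ + s₂) ^ 2) /
          (Real.sqrt ((l₁ - l₂) ^ 2 + (s₁ + s₂) ^ 2) + 2 * Real.sqrt (s₁ * s₂))) := by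
  set R := √((l₁ - l₂) ^ 2 + (s₁ + s₂) ^ 2) with hR
  set q := √(s₁ * s₂) with hq
  have hR2 : R^2 = (l₁ - l₂) ^ 2 + (s₁ + s₂) ^ 2 := Real.sq_sqrt (by positivity)
  have hq2 : q^2 = s₁ * s₂ := Real.sq_sqrt (by positivity)
  have hRp : 0 < R := by positivity
  have hqp : 0 < q := by positivity
  set m := (s₁ * l₂ + s₂ * l₁)/(s₁ + s₂) with hm
  set σ := q * R / (s₁ + s₂) with hσ
  have hσp : 0 < σ := by positivity
  have hlog : ∀ x, log (cauchyPdf l₁ s₁ x / ((cauchyPdf l₁ s₁ x + cauchyPdf l₂ s₂ x) / 2)) =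
      log (2 * s₁ / (s₁ + s₂)) + log (s₂^2 + (x - l₂)^2) - log (σ^2 + (x - m)^2) := by
    intro x
    rw [← log_mul (by positivity) (by positivity), ← log_div (by positivity) (by positivity)]
    congr 1
    have hQ : σ^2 + (x-m)^2 =
        (s₁ * (s₂^2 + (x - l₂)^2) + s₂ * (s₁^2 + (x - l₁)^2)) / (s₁ + s₂) := by
      rw [hσ, hm, div_pow, mul_pow, hR2, hq2]
      field_simp
      ring
    rw [hQ]
    simp only [cauchyPdf]
    have hA : 0 < s₁^2 + (x - l₁)^2 := by positivity
    have hB : 0 < s₂^2 + (x - l₂)^2 := by positivity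
    generalize s₁^2 + (x - l₁)^2 = A at *
    generalize s₂^2 + (x - l₂)^2 = B at *
    field_simp
  have k1 := key_one l₁ s₁ hs₁ (log (2 * s₁ / (s₁ + s₂)))
  have k2 := key l₁ s₁ l₂ s₂ hs₁ hs₂
  have k3 := key l₁ s₁ m σ hs₁ hσp
  simp only [hlog, mul_sub, mul_add]
  have k12 : Integrable (fun x => cauchyPdf l₁ s₁ x * log (2 * s₁ / (s₁ + s₂)) +
      cauchyPdf l₁ s₁ x * log (s₂ ^ 2 + (x - l₂) ^ 2)) := k1.1.add k2.1
  rw [integral_sub k12 k3.1, integral_add k1.1 k2.1, k1.2, k2.2, k3.2, ← hR2]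
  have h3 : (l₁ - m)^2 + (s₁ + σ)^2 = s₁ * R * (R + 2 * q) / (s₁ + s₂) := by
    rw [hσ, hm]
    field_simp
    ring_nf
    rw [hq2, hR2]
    ring_nf
  rw [h3, ← log_mul (by positivity) (by positivity), ← log_div (by positivity) (by positivity)]
  congr 1
  field_simp

theorem js_cauchy (l₁ l₂ s₁ s₂ : ℝ) (hs₁ : 0 < s₁) (hs₂ : 0 < s₂) :
    (1 / 2) * (∫ x : ℝ, cauchyPdf l₁ s₁ x *
        Real.log (cauchyPdf l₁ s₁ x / ((cauchyPdf l₁ s₁ x + cauchyPdf l₂ s₂ x) / 2))) +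
    (1 / 2) * (∫ x : ℝ, cauchyPdf l₂ s₂ x *
        Real.log (cauchyPdf l₂ s₂ x / ((cauchyPdf l₁ s₁ x + cauchyPdf l₂ s₂ x) / 2)))
      = Real.log (2 * Real.sqrt ((l₁ - l₂) ^ 2 + (s₁ + s₂) ^ 2) /
          (Real.sqrt ((l₁ - l₂) ^ 2 + (s₁ + s₂) ^ 2) + 2 * Real.sqrt (s₁ * s₂))) := by
  have h1 := half l₁ l₂ s₁ s₂ hs₁ hs₂
  have h2 := half l₂ l₁ s₂ s₁ hs₂ hs₁
  have e1 : (l₂ - l₁)^2 + (s₂ + s₁)^2 = (l₁ - l₂)^2 + (s₁ + s₂)^2 := by ring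
  rw [e1, mul_comm s₂ s₁] at h2
  simp only [add_comm (cauchyPdf l₂ s₂ _)] at h2
  rw [h1, h2]
  ring
end

section
/- For all l1, l2 ∈ ℝ and s1, s2 > 0, the Taneja divergence between Cauchy densities satisfies ∫_ℝ ((p_{l1,s1}(x)+p_{l2,s2}(x))/2) * log( (p_{l1,s1}(x)+p_{l2,s2}(x)) / (2*sqrt(p_{l1,s1}(x)*p_{l2,s2}(x))) ) dx = log( (1 + sqrt(((s1+s2)^2 + (l1-l2)^2)/(4*s1*s2)))/2 ). -/
open MeasureTheory Real

lemma int_pair_add {f g : ℝ → ℝ} {a b : ℝ} (hf : Integrable f ∧ ∫ x, f x = a)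
    (hg : Integrable g ∧ ∫ x, g x = b) :
    Integrable (fun x => f x + g x) ∧ ∫ x, (f x + g x) = a + b :=
  ⟨hf.1.add hg.1, by rw [integral_add hf.1 hg.1, hf.2, hg.2]⟩

lemma int_pair_sub {f g : ℝ → ℝ} {a b : ℝ} (hf : Integrable f ∧ ∫ x, f x = a)
    (hg : Integrable g ∧ ∫ x, g x = b) :
    Integrable (fun x => f x - g x) ∧ ∫ x, (f x - g x) = a - b :=
  ⟨hf.1.sub hg.1, by rw [integral_sub hf.1 hg.1, hf.2, hg.2]⟩

lemma int_pair_mul {f : ℝ → ℝ} {a : ℝ} (c : ℝ) (hf : Integrable f ∧ ∫ x, f x = a) :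
    Integrable (fun x => c * f x) ∧ ∫ x, (c * f x) = c * a :=
  ⟨hf.1.const_mul c, by rw [integral_const_mul, hf.2]⟩

lemma cauchy_circle_transfer (l s : ℝ) (hs : 0 < s) (F : ℂ → ℝ) (hF : CircleIntegrable F 0 1) :
    Integrable (fun x => cauchyPdf l s x * F (circleMap 0 1 (π + 2 * arctan ((x - l) / s)))) ∧
    ∫ x, cauchyPdf l s x * F (circleMap 0 1 (π + 2 * arctan ((x - l) / s)))
      = circleAverage F 0 1 := by
  have hd : ∀ x ∈ (Set.univ : Set ℝ), HasDerivWithinAt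
      (fun x => π + 2 * arctan ((x - l) / s)) (2 * π * cauchyPdf l s x) Set.univ x := by
    intro x _
    apply HasDerivAt.hasDerivWithinAt
    have h1 := (((((hasDerivAt_id x).sub_const l).div_const s).arctan).const_mul 2).const_add π
    simp only [id] at h1
    refine h1.congr_deriv ?_
    unfold cauchyPdf
    have : s ^ 2 + (x - l) ^ 2 ≠ 0 := by positivity
    have h3 : 1 + ((x - l) / s) ^ 2 ≠ 0 := by positivity
    field_simp
  have hinj : Set.InjOn (fun x => π + 2 * arctan ((x - l) / s)) Set.univ := by
    intro x _ y _ h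
    have h2 : arctan ((x - l) / s) = arctan ((y - l) / s) := by
      simp only at h; linarith
    have h3 := arctan_injective h2
    field_simp at h3
    linarith
  have himg : (fun x => π + 2 * arctan ((x - l) / s)) '' Set.univ = Set.Ioo 0 (2 * π) := by
    ext θ
    constructor
    · rintro ⟨x, _, rfl⟩
      have := neg_pi_div_two_lt_arctan ((x - l) / s)
      have := arctan_lt_pi_div_two ((x - l) / s)
      constructor <;> simp only <;> linarith
    · rintro ⟨h1, h2⟩
      refine ⟨l + s * tan ((θ - π) / 2), trivial, ?_⟩
      have : (l + s * tan ((θ - π) / 2) - l) / s = tan ((θ - π) / 2) := by field_simp; ring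
      simp only [this]
      rw [arctan_tan (by linarith) (by linarith)]
      ring
  have hpos : ∀ x, 0 ≤ cauchyPdf l s x := by intro x; unfold cauchyPdf; positivity
  have habs : ∀ x, |2 * π * cauchyPdf l s x| = 2 * π * cauchyPdf l s x := by
    intro x; exact abs_of_nonneg (mul_nonneg (by positivity) (hpos x))
  have hI := integrableOn_image_iff_integrableOn_abs_deriv_smul MeasurableSet.univ hd hinj
    (fun θ => F (circleMap 0 1 θ))
  have hE := integral_image_eq_integral_abs_deriv_smul MeasurableSet.univ hd hinj
    (fun θ => F (circleMap 0 1 θ))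
  rw [himg] at hI hE
  simp only [habs, smul_eq_mul, integrableOn_univ, Measure.restrict_univ] at hI hE
  simp only [mul_assoc] at hI hE
  have hp : (0:ℝ) ≤ 2 * π := by positivity
  have hF' : IntegrableOn (fun θ => F (circleMap 0 1 θ)) (Set.Ioo 0 (2 * π)) := by
    rw [← intervalIntegrable_iff_integrableOn_Ioo_of_le hp]
    exact hF
  have h1 := hI.1 hF'
  constructor
  · have h2 := h1.const_mul (2 * π)⁻¹
    convert h2 using 2 with x
    field_simp
  · rw [circleAverage_def, intervalIntegral.integral_of_le hp, integral_Ioc_eq_integral_Ioo, hE,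
      integral_const_mul, integral_const_mul, smul_eq_mul]
    field_simp

lemma circleMap_arctan (y : ℝ) :
    circleMap 0 1 (π + 2 * arctan y) * (1 - Complex.I * y) = -(1 + Complex.I * y) := by
  have h1 : circleMap 0 1 (π + 2 * arctan y)
      = -((cos (arctan y) : ℂ) + sin (arctan y) * Complex.I) ^ 2 := by
    simp only [circleMap]
    push_cast
    rw [← Complex.exp_mul_I, ← Complex.exp_nat_mul, add_mul, Complex.exp_add, Complex.exp_pi_mul_I]
    push_cast
    simp
    ring_nf
  have h2 : (sin (arctan y)) = y * cos (arctan y) := by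
    rw [sin_arctan, cos_arctan]; ring
  have h3 : (cos (arctan y) : ℂ) ^ 2 * (1 + y ^ 2) = 1 := by
    have : cos (arctan y) ^ 2 * (1 + y ^ 2) = 1 := by
      rw [cos_sq_arctan]; field_simp
    exact_mod_cast this
  rw [h1, h2, Complex.ofReal_mul]
  linear_combination (-(1 + Complex.I * y)) * h3 +
    (cos (arctan y) : ℂ) ^ 2 * (y^2 + y ^ 3 * Complex.I) * Complex.I_sq

lemma cauchy_pdf_one (l s : ℝ) (hs : 0 < s) :
    Integrable (fun x => cauchyPdf l s x) ∧ ∫ x, cauchyPdf l s x = 1 := by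
  have h := cauchy_circle_transfer l s hs (fun _ => 1) (circleIntegrable_const _ _ _)
  simpa [circleAverage_const] using h

lemma cauchy_log (l s m t : ℝ) (hs : 0 < s) (ht : 0 < t) :
    Integrable (fun x => cauchyPdf l s x * log (t ^ 2 + (x - m) ^ 2)) ∧
    ∫ x, cauchyPdf l s x * log (t ^ 2 + (x - m) ^ 2) = log ((s + t) ^ 2 + (l - m) ^ 2) := by
  set A : ℂ := ⟨l - m, -(t + s)⟩ with hA
  set B : ℂ := ⟨l - m, -(t - s)⟩ with hB
  have nA : ‖A‖ ^ 2 = (s + t) ^ 2 + (l - m) ^ 2 := by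
    rw [Complex.sq_norm, Complex.normSq_apply]; simp only [hA]; ring
  have nB : ‖B‖ ^ 2 = (s - t) ^ 2 + (l - m) ^ 2 := by
    rw [Complex.sq_norm, Complex.normSq_apply]; simp only [hB]; ring
  have hA0 : A ≠ 0 := by
    intro h; rw [h] at nA; simp at nA
    have : 0 < (s + t) ^ 2 + (l - m) ^ 2 := by positivity
    linarith
  have hw : ‖B / A‖ < 1 := by
    rw [norm_div, div_lt_one (norm_pos_iff.2 hA0)]
    apply lt_of_pow_lt_pow_left₀ 2 (norm_nonneg _)
    rw [nA, nB]
    nlinarith [mul_pos hs ht]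
  have c0 : CircleIntegrable (fun z : ℂ => log ‖z - B / A‖) 0 1 :=
    circleIntegrable_log_norm_sub_const 1
  have c1 : CircleIntegrable (fun z : ℂ => log ‖z - 1‖) 0 1 :=
    circleIntegrable_log_norm_sub_const 1
  have e0 := cauchy_circle_transfer l s hs _ c0
  have e1 := cauchy_circle_transfer l s hs _ c1
  have e2 := cauchy_pdf_one l s hs
  rw [circleAverage_log_norm_sub_const₀ hw] at e0
  rw [circleAverage_log_norm_sub_const₁ (by simp)] at e1
  have key : ∀ x, cauchyPdf l s x * log (t ^ 2 + (x - m) ^ 2) =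
      log ((s + t) ^ 2 + (l - m) ^ 2) * cauchyPdf l s x +
      (2 * (cauchyPdf l s x * log ‖circleMap 0 1 (π + 2 * arctan ((x - l) / s)) - B / A‖)
      - 2 * (cauchyPdf l s x * log ‖circleMap 0 1 (π + 2 * arctan ((x - l) / s)) - 1‖)) := by
    intro x
    set y := (x - l) / s with hy
    have hx : x = l + s * y := by rw [hy]; field_simp; ring
    have hz := circleMap_arctan y
    set z := circleMap 0 1 (π + 2 * arctan y) with hzdef
    have hyne : (1 - Complex.I * y : ℂ) ≠ 0 := by
      intro h
      have := congrArg Complex.re h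
      simp at this
    set C : ℂ := ⟨x - m, -t⟩ with hC
    have nC : ‖C‖ ^ 2 = t ^ 2 + (x - m) ^ 2 := by
      rw [Complex.sq_norm, Complex.normSq_apply]; simp only [hC]; ring
    have hA' : A = (l - m) - (t + s) * Complex.I := by
      apply Complex.ext <;> simp [hA]
    have hB' : B = (l - m) - (t - s) * Complex.I := by
      apply Complex.ext <;> simp [hB]
    have hC' : C = (l + s * y - m) - t * Complex.I := by
      apply Complex.ext <;> simp [hC, hx]
    have id1 : A * (z - B / A) = C * (z - 1) := by
      have : A * (z - B / A) = A * z - B := by field_simp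
      rw [this]
      apply mul_right_cancel₀ hyne
      have : (A * z - B) * (1 - Complex.I * y) - C * (z - 1) * (1 - Complex.I * y) = 0 := by
        have h1 : (A * z - B) * (1 - Complex.I * y) - C * (z - 1) * (1 - Complex.I * y)
          = (A - C) * (z * (1 - Complex.I * y)) + (C - B) * (1 - Complex.I * y) := by ring
        rw [h1, hz, hA', hB', hC']
        ring_nf
        simp only [Complex.I_sq]
        ring
      exact sub_eq_zero.1 this
    have hz1 : z - 1 ≠ 0 := by
      intro h
      have h1 : z = 1 := sub_eq_zero.1 h
      rw [h1] at hz
      have := congrArg Complex.re hz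
      simp at this
      norm_num at this
    have hC0 : C ≠ 0 := by
      intro h; rw [h] at nC; simp at nC
      have : 0 < t ^ 2 + (x - m) ^ 2 := by positivity
      linarith
    have hzw : z - B / A ≠ 0 := by
      intro h; rw [h, mul_zero] at id1
      exact mul_ne_zero hC0 hz1 id1.symm
    have id2 := congrArg (fun u => log ‖u‖) id1
    simp only [norm_mul] at id2
    rw [log_mul (norm_ne_zero_iff.2 hA0) (norm_ne_zero_iff.2 hzw),
      log_mul (norm_ne_zero_iff.2 hC0) (norm_ne_zero_iff.2 hz1)] at id2
    rw [← nC, ← nA, log_pow, log_pow]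
    push_cast
    linear_combination (-2 * cauchyPdf l s x) * id2
  simp only [key]
  have h := int_pair_add (int_pair_mul (log ((s + t) ^ 2 + (l - m) ^ 2)) e2)
    (int_pair_sub (int_pair_mul 2 e0) (int_pair_mul 2 e1))
  refine ⟨h.1, h.2.trans ?_⟩
  ring

theorem taneja_cauchy (l₁ l₂ s₁ s₂ : ℝ) (hs₁ : 0 < s₁) (hs₂ : 0 < s₂) :
    ∫ x : ℝ, ((cauchyPdf l₁ s₁ x + cauchyPdf l₂ s₂ x) / 2) *
        Real.log ((cauchyPdf l₁ s₁ x + cauchyPdf l₂ s₂ x) /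
          (2 * Real.sqrt (cauchyPdf l₁ s₁ x * cauchyPdf l₂ s₂ x)))
      = Real.log ((1 + Real.sqrt (((s₁ + s₂) ^ 2 + (l₁ - l₂) ^ 2) / (4 * s₁ * s₂))) / 2) := by
  set R := Real.sqrt (((s₁ + s₂) ^ 2 + (l₁ - l₂) ^ 2) / (4 * s₁ * s₂)) with hR
  have hRpos : 0 < R := by rw [hR]; positivity
  have hR2 : 4 * s₁ * s₂ * R ^ 2 = (s₁ + s₂) ^ 2 + (l₁ - l₂) ^ 2 := by
    rw [hR, sq_sqrt (by positivity)]; field_simp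
  set S := s₁ + s₂ with hS
  have hSpos : 0 < S := by positivity
  set t := 2 * s₁ * s₂ * R / S with ht
  have htpos : 0 < t := by positivity
  set m := (s₁ * l₂ + s₂ * l₁) / S with hm
  have m1 : l₁ - m = s₁ * (l₁ - l₂) / S := by rw [hm]; field_simp; rw [hS]; ring
  have m2 : l₂ - m = - (s₂ * (l₁ - l₂) / S) := by rw [hm]; field_simp; rw [hS]; ring
  have hd : (l₁ - l₂) ^ 2 = 4 * s₁ * s₂ * R ^ 2 - S ^ 2 := by linarith
  have V1 : (s₁ + t) ^ 2 + (l₁ - m) ^ 2 = 4 * s₁ ^ 2 * s₂ * R * (R + 1) / S := by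
    rw [m1, div_pow, mul_pow, hd, ht]; field_simp; rw [hS]; ring
  have V2 : (s₂ + t) ^ 2 + (l₂ - m) ^ 2 = 4 * s₂ ^ 2 * s₁ * R * (R + 1) / S := by
    rw [m2, neg_sq, div_pow, mul_pow, hd, ht]; field_simp; rw [hS]; ring
  have Q : ∀ x, s₁ * (s₂ ^ 2 + (x - l₂) ^ 2) + s₂ * (s₁ ^ 2 + (x - l₁) ^ 2)
      = S * (t ^ 2 + (x - m) ^ 2) := by
    intro x
    have h1 : x - l₁ = (x - m) - s₁ * (l₁ - l₂) / S := by rw [← m1]; ring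
    have h2 : x - l₂ = (x - m) + s₂ * (l₁ - l₂) / S := by
      have := m2; linarith
    have h3 : t ^ 2 = s₁ * s₂ * ((l₁ - l₂) ^ 2 + S ^ 2) / S ^ 2 := by
      rw [hd, ht]; field_simp; ring
    rw [h1, h2, h3]
    field_simp
    rw [hS]; ring
  have key : ∀ x, ((cauchyPdf l₁ s₁ x + cauchyPdf l₂ s₂ x) / 2) *
        Real.log ((cauchyPdf l₁ s₁ x + cauchyPdf l₂ s₂ x) /
          (2 * Real.sqrt (cauchyPdf l₁ s₁ x * cauchyPdf l₂ s₂ x))) =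
      ((log S - log 2 - (log s₁ + log s₂) / 2) / 2 * cauchyPdf l₁ s₁ x
       + (log S - log 2 - (log s₁ + log s₂) / 2) / 2 * cauchyPdf l₂ s₂ x)
      + (((1 / 2) * (cauchyPdf l₁ s₁ x * log (t ^ 2 + (x - m) ^ 2))
       + (1 / 2) * (cauchyPdf l₂ s₂ x * log (t ^ 2 + (x - m) ^ 2)))
      + (((-1 / 4) * (cauchyPdf l₁ s₁ x * log (s₁ ^ 2 + (x - l₁) ^ 2))
       + (-1 / 4) * (cauchyPdf l₂ s₂ x * log (s₁ ^ 2 + (x - l₁) ^ 2)))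
      + ((-1 / 4) * (cauchyPdf l₁ s₁ x * log (s₂ ^ 2 + (x - l₂) ^ 2))
       + (-1 / 4) * (cauchyPdf l₂ s₂ x * log (s₂ ^ 2 + (x - l₂) ^ 2))))) := by
    intro x
    have q1 : 0 < s₁ ^ 2 + (x - l₁) ^ 2 := by positivity
    have q2 : 0 < s₂ ^ 2 + (x - l₂) ^ 2 := by positivity
    have q0 : 0 < t ^ 2 + (x - m) ^ 2 := by positivity
    have p1 : 0 < cauchyPdf l₁ s₁ x := by unfold cauchyPdf; positivity
    have p2 : 0 < cauchyPdf l₂ s₂ x := by unfold cauchyPdf; positivity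
    have hsum : cauchyPdf l₁ s₁ x + cauchyPdf l₂ s₂ x = S * (t ^ 2 + (x - m) ^ 2) /
        (π * ((s₁ ^ 2 + (x - l₁) ^ 2) * (s₂ ^ 2 + (x - l₂) ^ 2))) := by
      rw [← Q]; unfold cauchyPdf; field_simp
    have L : Real.log ((cauchyPdf l₁ s₁ x + cauchyPdf l₂ s₂ x) /
          (2 * Real.sqrt (cauchyPdf l₁ s₁ x * cauchyPdf l₂ s₂ x))) =
        (log S - log 2 - (log s₁ + log s₂) / 2) + log (t ^ 2 + (x - m) ^ 2)
        - log (s₁ ^ 2 + (x - l₁) ^ 2) / 2 - log (s₂ ^ 2 + (x - l₂) ^ 2) / 2 := by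
      rw [log_div (by positivity) (by positivity), log_mul (by positivity) (by positivity),
        log_sqrt (by positivity), log_mul p1.ne' p2.ne', hsum]
      unfold cauchyPdf
      rw [log_div (by positivity) (by positivity), log_div (by positivity) (by positivity),
        log_div (by positivity) (by positivity), log_mul hSpos.ne' q0.ne',
        log_mul pi_pos.ne' (by positivity), log_mul pi_pos.ne' (by positivity),
        log_mul pi_pos.ne' (by positivity), log_mul q1.ne' q2.ne']
      ring
    rw [L]; ring
  simp only [key]
  have a1 := cauchy_pdf_one l₁ s₁ hs₁
  have a2 := cauchy_pdf_one l₂ s₂ hs₂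
  have b1 := cauchy_log l₁ s₁ m t hs₁ htpos
  have b2 := cauchy_log l₂ s₂ m t hs₂ htpos
  have c1 := cauchy_log l₁ s₁ l₁ s₁ hs₁ hs₁
  have c2 := cauchy_log l₂ s₂ l₁ s₁ hs₂ hs₁
  have d1 := cauchy_log l₁ s₁ l₂ s₂ hs₁ hs₂
  have d2 := cauchy_log l₂ s₂ l₂ s₂ hs₂ hs₂
  have A1 := int_pair_mul ((log S - log 2 - (log s₁ + log s₂) / 2) / 2) a1
  have A2 := int_pair_mul ((log S - log 2 - (log s₁ + log s₂) / 2) / 2) a2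
  have B1 := int_pair_mul (1 / 2) b1
  have B2 := int_pair_mul (1 / 2) b2
  have C1 := int_pair_mul (-1 / 4) c1
  have C2 := int_pair_mul (-1 / 4) c2
  have D1 := int_pair_mul (-1 / 4) d1
  have D2 := int_pair_mul (-1 / 4) d2
  refine (int_pair_add (int_pair_add A1 A2) (int_pair_add (int_pair_add B1 B2)
    (int_pair_add (int_pair_add C1 C2) (int_pair_add D1 D2)))).2.trans ?_
  rw [V1, V2]
  have W1 : (s₁ + s₁) ^ 2 + (l₁ - l₁) ^ 2 = (2 * s₁) ^ 2 := by ring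
  have W2 : (s₂ + s₂) ^ 2 + (l₂ - l₂) ^ 2 = (2 * s₂) ^ 2 := by ring
  have W3 : (s₂ + s₁) ^ 2 + (l₂ - l₁) ^ 2 = 2 ^ 2 * s₁ * s₂ * R ^ 2 := by
    linear_combination -hR2
  have W4 : (s₁ + s₂) ^ 2 + (l₁ - l₂) ^ 2 = 2 ^ 2 * s₁ * s₂ * R ^ 2 := by
    linear_combination -hR2
  have h4 : (4:ℝ) = 2 ^ 2 := by norm_num
  have X1 : log (4 * s₁ ^ 2 * s₂ * R * (R + 1) / S)
      = 2 * log 2 + 2 * log s₁ + log s₂ + log R + log (R + 1) - log S := by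
    rw [h4, log_div (by positivity) (by positivity), log_mul (by positivity) (by positivity),
      log_mul (by positivity) (by positivity), log_mul (by positivity) (by positivity),
      log_mul (by positivity) (by positivity), log_pow, log_pow]
    push_cast; ring
  have X2 : log (4 * s₂ ^ 2 * s₁ * R * (R + 1) / S)
      = 2 * log 2 + 2 * log s₂ + log s₁ + log R + log (R + 1) - log S := by
    rw [h4, log_div (by positivity) (by positivity), log_mul (by positivity) (by positivity),
      log_mul (by positivity) (by positivity), log_mul (by positivity) (by positivity),
      log_mul (by positivity) (by positivity), log_pow, log_pow]
    push_cast; ring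
  have X3 : log (2 ^ 2 * s₁ * s₂ * R ^ 2) = 2 * log 2 + log s₁ + log s₂ + 2 * log R := by
    rw [log_mul (by positivity) (by positivity), log_mul (by positivity) (by positivity),
      log_mul (by positivity) (by positivity), log_pow, log_pow]
    push_cast; ring
  rw [W1, W2, W3, W4, X1, X2, X3, log_pow, log_pow, log_mul two_ne_zero hs₁.ne',
    log_mul two_ne_zero hs₂.ne', log_div (by positivity) two_ne_zero, add_comm 1 R]
  push_cast
  ring
end
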